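/- Let G be a simple undirected graph on N vertices in which every vertex has positive degree, let δ ≥ 0 and α ≥ δ·(d_max − 1), where d_max is the maximum degree, and let W = (α+δ)·Δ⁻¹·(A∘A² + A)·Δ⁻¹ − (δ/2)·(Δ⁻¹·A + A·Δ⁻¹). Then every off-diagonal entry of W is nonnegative: w_{ij} ≥ 0 for all i ≠ j. -/

import Mathlib

open Matrix Finset

/-- The LCP matrix `W = (α+δ)·Δ⁻¹·(A∘A² + A)·Δ⁻¹ − (δ/2)·(Δ⁻¹·A + A·Δ⁻¹)`. -/
noncomputable def lcpW {N : ℕ} (G : SimpleGraph (Fin N)) [DecidableRel G.Adj] (α δ : ℝ) :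
    Matrix (Fin N) (Fin N) ℝ :=
  (α + δ) • ((Matrix.diagonal fun i => (G.degree i : ℝ))⁻¹ *
      (Matrix.hadamard (G.adjMatrix ℝ) (G.adjMatrix ℝ ^ 2) + G.adjMatrix ℝ) *
      (Matrix.diagonal fun i => (G.degree i : ℝ))⁻¹) -
    (δ / 2) • ((Matrix.diagonal fun i => (G.degree i : ℝ))⁻¹ * G.adjMatrix ℝ +
      G.adjMatrix ℝ * (Matrix.diagonal fun i => (G.degree i : ℝ))⁻¹)

/-- Entrywise formula for the LCP matrix of a graph without isolated vertices. -/
theorem lcpW_apply {N : ℕ} (G : SimpleGraph (Fin N)) [DecidableRel G.Adj] (α δ : ℝ)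
    (hd : ∀ i, 0 < G.degree i) (i j : Fin N) :
    lcpW G α δ i j = G.adjMatrix ℝ i j *
      (((α + δ) * ((G.adjMatrix ℝ ^ 2) i j + 1) - δ * ((G.degree i + G.degree j) / 2)) /
        (G.degree i * G.degree j)) := by
  have hne : ∀ k, (G.degree k : ℝ) ≠ 0 := fun k => by exact_mod_cast (hd k).ne'
  have hinv : (Matrix.diagonal fun k => (G.degree k : ℝ))⁻¹ =
      Matrix.diagonal fun k => (G.degree k : ℝ)⁻¹ := by
    apply Matrix.inv_eq_right_inv
    rw [Matrix.diagonal_mul_diagonal, ← Matrix.diagonal_one]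
    exact congrArg _ (funext fun k => mul_inv_cancel₀ (hne k))
  have hi := hne i
  have hj := hne j
  rw [lcpW, hinv]
  simp only [Matrix.sub_apply, Matrix.smul_apply, Matrix.add_apply, Matrix.mul_diagonal,
    Matrix.diagonal_mul, Matrix.hadamard_apply, smul_eq_mul]
  field_simp
  ring

/-- If `δ ≥ 0` and `α ≥ δ·(d_max − 1)`, then every off-diagonal entry of
the LCP matrix `W` is nonnegative. -/
theorem stmt_7 {N : ℕ} [NeZero N] (G : SimpleGraph (Fin N)) [DecidableRel G.Adj]
    (α δ : ℝ) (hd : ∀ i, 0 < G.degree i) (hδ : 0 ≤ δ)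
    (hα : δ * ((Finset.univ.sup' Finset.univ_nonempty (fun i => G.degree i) : ℝ) - 1) ≤ α) :
    ∀ i j : Fin N, i ≠ j → 0 ≤ lcpW G α δ i j := by
  intro i j _
  have hsup : ∀ k, (G.degree k : ℝ) ≤
      Finset.univ.sup' Finset.univ_nonempty (fun i => (G.degree i : ℝ)) := fun k =>
    Finset.le_sup' (fun i => (G.degree i : ℝ)) (Finset.mem_univ k)
  have hi : (0 : ℝ) < G.degree i := by exact_mod_cast hd i
  have hj : (0 : ℝ) < G.degree j := by exact_mod_cast hd j
  have hsum : δ * ((G.degree i + G.degree j) / 2) ≤ α + δ := by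
    nlinarith [mul_le_mul_of_nonneg_left (hsup i) hδ, mul_le_mul_of_nonneg_left (hsup j) hδ]
  rw [lcpW_apply G α δ hd]
  by_cases h : G.Adj i j
  · have hT : 0 ≤ (G.adjMatrix ℝ ^ 2) i j := by
      rw [pow_two, Matrix.mul_apply]
      refine Finset.sum_nonneg fun k _ => mul_nonneg ?_ ?_ <;>
        · rw [SimpleGraph.adjMatrix_apply]
          split_ifs <;> norm_num
    have hαδ : 0 ≤ α + δ := le_trans (by positivity) hsum
    rw [SimpleGraph.adjMatrix_apply, if_pos h, one_mul]
    apply div_nonneg _ (by positivity)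
    nlinarith [mul_nonneg hαδ hT]
  · simp [SimpleGraph.adjMatrix_apply, h]
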